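/- Let ⟨U_k : k ∈ ℕ⟩ be pairwise non-isomorphic Ramsey ultrafilters on ℕ. Then the set V = { X ⊆ ℕ × ℕ : { k ∈ ℕ : k > 0 and { i ∈ ℕ : (k,i) ∈ X } ∈ U_k } ∈ U_0 } is a free ultrafilter on ℕ × ℕ that is a Q-point but not Ramsey. -/

import Mathlib

/-- A (ultra)filter is free if it contains no finite set, equivalently
every member is infinite. -/
def FreeUf {S : Type} (U : Ultrafilter S) : Prop := ∀ A ∈ U, Set.Infinite A

/-- Isomorphism of ultrafilters: some bijection maps one to the other. -/
def UfIso {S T : Type} (U : Ultrafilter S) (V : Ultrafilter T) : Prop :=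
  ∃ f : S ≃ T, Ultrafilter.map f U = V

/-- A Ramsey ultrafilter on ℕ: free, and every 2-coloring of pairs has a
monochromatic member. -/
def IsRamseyUf (U : Ultrafilter ℕ) : Prop :=
  FreeUf U ∧ ∀ c : ℕ → ℕ → Fin 2, ∃ A : Set ℕ, A ∈ U ∧
    ∃ j : Fin 2, ∀ x ∈ A, ∀ y ∈ A, x < y → c x y = j

/-- A Q-point on ℕ: free, and for every partition of ℕ into finite sets
(encoded as a finite-to-one function, whose fibers are the pieces) there is a
member meeting each piece in at most one point. -/
def IsQPointUf (U : Ultrafilter ℕ) : Prop :=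
  FreeUf U ∧ ∀ f : ℕ → ℕ, (∀ m, (f ⁻¹' {m}).Finite) →
    ∃ A : Set ℕ, A ∈ U ∧ Set.InjOn f A

/-- Q-point on a countably infinite type: free, and for every partition into
finite sets (fibers of a finite-to-one map to ℕ) some member meets each piece
in at most one point. -/
def IsQPointOn {S : Type} (U : Ultrafilter S) : Prop :=
  FreeUf U ∧ ∀ f : S → ℕ, (∀ m, (f ⁻¹' {m}).Finite) →
    ∃ A : Set S, A ∈ U ∧ Set.InjOn f A

/-- Ramsey ultrafilter on a type: free, and every symmetric 2-coloring of
pairs has a monochromatic member. -/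
def IsRamseyOn {S : Type} (U : Ultrafilter S) : Prop :=
  FreeUf U ∧ ∀ c : S → S → Fin 2, (∀ x y, c x y = c y x) →
    ∃ A : Set S, A ∈ U ∧ ∃ j : Fin 2, ∀ x ∈ A, ∀ y ∈ A, x ≠ y → c x y = j

/-- An infinite member of an ultrafilter contains a member whose relative complement is infinite. -/
theorem Ultrafilter.exists_subset_infinite_diff {S : Type} (U : Ultrafilter S) {A : Set S}
    (hA : A ∈ U) (hinf : A.Infinite) : ∃ B ∈ U, B ⊆ A ∧ (A \ B).Infinite := by
  let e := hinf.natEmbedding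
  have he : ∀ m n, (e m : S) = e n → m = n := fun m n h => e.injective (Subtype.ext h)
  let E : Set S := Set.range fun n => (e (2 * n) : S)
  by_cases hE : E ∈ U
  · refine ⟨E, hE, ?_, ?_⟩
    · rintro _ ⟨n, rfl⟩
      exact (e (2 * n)).2
    · refine (Set.infinite_range_of_injective (f := fun n => (e (2 * n + 1) : S)) ?_).mono ?_
      · intro m n h
        have := he _ _ h
        omega
      · rintro _ ⟨n, rfl⟩
        refine ⟨(e (2 * n + 1)).2, ?_⟩
        rintro ⟨m, hm⟩
        have := he _ _ hm
        omega
  · refine ⟨A ∩ Eᶜ, Filter.inter_mem hA (Ultrafilter.compl_mem_iff_notMem.2 hE),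
      Set.inter_subset_left, ?_⟩
    refine (Set.infinite_range_of_injective (f := fun n => (e (2 * n) : S)) ?_).mono ?_
    · intro m n h
      have := he _ _ h
      omega
    · rintro _ ⟨n, rfl⟩
      exact ⟨(e (2 * n)).2, fun h => h.2 ⟨n, rfl⟩⟩

/-- The image of a free ultrafilter under a map that is injective on a member is also its image
under a bijection. -/
theorem FreeUf.exists_equiv_map_eq {S T : Type} [Countable S] [Countable T] {U : Ultrafilter S}
    (hU : FreeUf U) {f : S → T} {A : Set S} (hA : A ∈ U) (hf : Set.InjOn f A) :
    ∃ e : S ≃ T, Ultrafilter.map e U = Ultrafilter.map f U := by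
  obtain ⟨B, hB, hBA, hinf⟩ := U.exists_subset_infinite_diff hA (hU A hA)
  let g : B ↪ T := ⟨fun x => f x, fun x y h => Subtype.ext (hf (hBA x.2) (hBA y.2) h)⟩
  have h1 : Infinite (Bᶜ : Set S) :=
    Set.infinite_coe_iff.2 (hinf.mono fun x hx => hx.2)
  have h2 : Infinite ((Set.range g)ᶜ : Set T) := by
    refine Set.infinite_coe_iff.2 ((hinf.image (hf.mono Set.sdiff_subset)).mono ?_)
    rintro _ ⟨x, hx, rfl⟩ ⟨y, hy⟩
    exact hx.2 (hf (hBA y.2) hx.1 hy ▸ y.2)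
  obtain ⟨e, he⟩ := Cardinal.extend_function g (nonempty_equiv_of_countable)
  refine ⟨e, Ultrafilter.coe_injective ?_⟩
  exact Filter.map_congr (Filter.mem_of_superset hB fun x hx => he ⟨x, hx⟩)

theorem FreeUf.compl_mem_of_finite {S : Type} {U : Ultrafilter S} (hU : FreeUf U) {F : Set S}
    (hF : F.Finite) : Fᶜ ∈ U :=
  Ultrafilter.compl_mem_iff_notMem.2 fun h => hU F h hF

/-- Ramsey ultrafilters are Q-points. -/
theorem IsRamseyUf.isQPointUf {U : Ultrafilter ℕ} (hU : IsRamseyUf U) : IsQPointUf U := by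
  classical
  refine ⟨hU.1, fun f hf => ?_⟩
  obtain ⟨A, hA, j, hj⟩ := hU.2 fun x y => if f x = f y then 1 else 0
  refine ⟨A, hA, ?_⟩
  have hne : ∀ x ∈ A, ∀ y ∈ A, x < y → f x ≠ f y := by
    intro x hx y hy hxy h
    have hj1 : j = 1 := by rw [← hj x hx y hy hxy, if_pos h]
    refine hU.1 _ (Filter.inter_mem hA (hU.1.compl_mem_of_finite (hf (f x)))) ?_
    refine (Set.finite_Iic x).subset fun z hz => ?_
    by_contra hxz
    have := hj x hx z hz.1 (not_le.1 hxz)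
    rw [if_neg fun h' => hz.2 h'.symm, hj1] at this
    exact absurd this (by decide)
  intro x hx y hy h
  rcases lt_trichotomy x y with hxy | hxy | hxy
  · exact absurd h (hne x hx y hy hxy)
  · exact hxy
  · exact absurd h.symm (hne y hy x hx hxy)

/-- Ramsey ultrafilters are P-points. -/
theorem IsRamseyUf.exists_pseudointersection {U : Ultrafilter ℕ} (hU : IsRamseyUf U)
    (D : ℕ → Set ℕ) (hD : ∀ n, D n ∈ U) : ∃ A ∈ U, ∀ n, (A \ D n).Finite := by
  classical
  obtain ⟨A, hA, j, hj⟩ := hU.2 fun x y => if ∀ n ≤ x, y ∈ D n then 1 else 0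
  refine ⟨A, hA, fun n => ?_⟩
  obtain ⟨x, hx, hnx⟩ := (hU.1 A hA).exists_gt n
  have hmem : (A ∩ ⋂ m ∈ Set.Iic x, D m) ∈ U :=
    Filter.inter_mem hA ((Filter.biInter_mem (Set.finite_Iic x)).2 fun m _ => hD m)
  obtain ⟨y, hy, hxy⟩ := (hU.1 _ hmem).exists_gt x
  have hj1 : j = 1 := by
    rw [← hj x hx y hy.1 hxy, if_pos fun m (hm : m ≤ x) => Set.mem_iInter₂.1 hy.2 m hm]
  refine (Set.finite_Iic x).subset fun z hz => ?_
  by_contra hxz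
  have := hj x hx z hz.1 (not_le.1 hxz)
  rw [if_neg fun h => hz.2 (h n hnx.le), hj1] at this
  exact absurd this (by decide)

/-- Finite-to-one images of pairwise non-isomorphic Ramsey ultrafilters have pairwise disjoint
members. -/
theorem exists_pairwise_disjoint_mem_map {U : ℕ → Ultrafilter ℕ} (hU : ∀ k, IsRamseyUf (U k))
    (hpair : ∀ k l : ℕ, k ≠ l → ¬ UfIso (U k) (U l)) (f : ℕ → ℕ → ℕ)
    (hf : ∀ k m, (f k ⁻¹' {m}).Finite) :
    ∃ C : ℕ → Set ℕ, (∀ k, C k ∈ (U k).map (f k)) ∧ Pairwise (Function.onFun Disjoint C) := by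
  have hequiv : ∀ k, ∃ e : ℕ ≃ ℕ, (U k).map e = (U k).map (f k) := fun k =>
    let ⟨_, hA, hinj⟩ := (hU k).isQPointUf.2 (f k) (hf k)
    (hU k).1.exists_equiv_map_eq hA hinj
  choose e he using hequiv
  have hne : ∀ k l, k ≠ l → (U k).map (f k) ≠ (U l).map (f l) := by
    intro k l hkl h
    refine hpair k l hkl ⟨(e k).trans (e l).symm, ?_⟩
    rw [Equiv.coe_trans, ← Ultrafilter.map_map, he k, h, ← he l, Ultrafilter.map_map,
      Equiv.symm_comp_self, Ultrafilter.map_id]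
  have hsep : ∀ k l, ∃ B ∈ (U k).map (f k), k ≠ l → B ∉ (U l).map (f l) := by
    intro k l
    by_contra! h
    have hkl : k ≠ l := (h Set.univ Filter.univ_mem).1
    exact hne k l hkl (Ultrafilter.eq_of_le fun B hB => by
      by_contra hB'
      exact (Ultrafilter.compl_mem_iff_notMem.1 (h _ (Ultrafilter.compl_mem_iff_notMem.2 hB')).2) hB)
  choose B hB hBl using hsep
  choose E hE hEB using fun k => (hU k).exists_pseudointersection (fun l => f k ⁻¹' B k l) (hB k)
  have hmem : ∀ k, f k '' E k ∈ (U k).map (f k) := fun k => Filter.image_mem_map (hE k)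
  have hnot : ∀ k l, k ≠ l → f k '' E k ∉ (U l).map (f l) := by
    intro k l hkl h
    have hfin : (f l ⁻¹' (f k '' (E k \ f k ⁻¹' B k l))).Finite :=
      ((hEB k l).image _).preimage' fun m _ => hf l m
    refine hBl k l hkl (Ultrafilter.mem_map.2 ?_)
    filter_upwards [Ultrafilter.mem_map.1 h, (hU l).1.compl_mem_of_finite hfin] with x hx hx'
    obtain ⟨y, hy, hyx⟩ := hx
    by_contra hxB
    exact hx' ⟨y, ⟨hy, fun hyB => hxB (by rw [Set.mem_preimage, ← hyx]; exact hyB)⟩, hyx⟩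
  refine ⟨fun k => f k '' E k ∩ ⋂ l ∈ Set.Iio k, (f l '' E l)ᶜ, fun k => ?_, ?_⟩
  · exact Filter.inter_mem (hmem k) ((Filter.biInter_mem (Set.finite_Iio k)).2 fun l hl =>
      Ultrafilter.compl_mem_iff_notMem.2 (hnot l k (ne_of_lt hl)))
  · refine (pairwise_disjoint_on _).2 fun k l hkl => Set.disjoint_left.2 fun x hx hx' => ?_
    exact Set.mem_iInter₂.1 hx'.2 k hkl hx.1

/-- The `U_0`-indexed sum of the `U_k` (k > 0) is a free ultrafilter on
ℕ × ℕ which is a Q-point but not Ramsey. -/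
theorem indexed_sum_is_nonRamsey_qpoint (U : ℕ → Ultrafilter ℕ)
    (hU : ∀ k, IsRamseyUf (U k))
    (hpair : ∀ k l : ℕ, k ≠ l → ¬ UfIso (U k) (U l)) :
    ∃ V : Ultrafilter (ℕ × ℕ),
      (∀ X : Set (ℕ × ℕ), X ∈ V ↔
        {k : ℕ | 0 < k ∧ {i : ℕ | (k, i) ∈ X} ∈ U k} ∈ U 0) ∧
      IsQPointOn V ∧ ¬ IsRamseyOn V := by
  classical
  let V : Ultrafilter (ℕ × ℕ) := (U 0).bind fun k => (U k).map (Prod.mk k)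
  have hpos : {k : ℕ | 0 < k} ∈ U 0 :=
    Filter.mem_of_superset ((hU 0).1.compl_mem_of_finite (Set.finite_singleton 0))
      fun k hk => Nat.pos_of_ne_zero hk
  have hV : ∀ X : Set (ℕ × ℕ), X ∈ V ↔ {k : ℕ | {i : ℕ | (k, i) ∈ X} ∈ U k} ∈ U 0 :=
    fun X => Iff.rfl
  have hcol : ∀ X ∈ V, ∃ k, {i : ℕ | (k, i) ∈ X} ∈ U k :=
    fun X hX => (U 0).nonempty_of_mem ((hV X).1 hX)
  refine ⟨V, fun X => ?_, ⟨fun X hX hfin => ?_, fun f hf => ?_⟩, fun hR => ?_⟩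
  · rw [hV]
    exact ⟨fun h => Filter.inter_mem hpos h, fun h => Filter.mem_of_superset h fun k hk => hk.2⟩
  · obtain ⟨k, hk⟩ := hcol X hX
    exact (hU k).1 _ hk (hfin.preimage (Prod.mk_right_injective k).injOn)
  · have hfk : ∀ k m, ((fun i => f (k, i)) ⁻¹' {m}).Finite := fun k m =>
      (hf m).preimage (f := Prod.mk k) (Prod.mk_right_injective k).injOn
    choose A hA hinj using fun k => (hU k).isQPointUf.2 (fun i => f (k, i)) (hfk k)
    obtain ⟨C, hC, hdisj⟩ := exists_pairwise_disjoint_mem_map hU hpair (fun k i => f (k, i)) hfk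
    refine ⟨{p | p.2 ∈ A p.1 ∧ f p ∈ C p.1}, ?_, ?_⟩
    · exact (hV _).2 (Filter.univ_mem' fun k => Filter.inter_mem (hA k) (hC k))
    · rintro ⟨k, i⟩ ⟨hi, hCi⟩ ⟨l, j⟩ ⟨hj, hCj⟩ h
      obtain rfl : k = l := by
        by_contra hkl
        exact Set.disjoint_left.1 (hdisj hkl) hCi (h ▸ hCj)
      exact congrArg (Prod.mk k) (hinj k hi hj h)
  · obtain ⟨A, hA, j, hj⟩ := hR.2 (fun p q => if p.1 = q.1 then 1 else 0)
      fun p q => by simp only [eq_comm]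
    obtain ⟨k, hk⟩ := hcol A hA
    obtain ⟨a, ha⟩ := ((hU k).1 _ hk).nonempty
    obtain ⟨b, hb, hab⟩ := ((hU k).1 _ hk).exists_gt a
    have hj1 : j = 1 := by
      rw [← hj (k, a) ha (k, b) hb fun h => hab.ne (congrArg Prod.snd h), if_pos rfl]
    refine (hU 0).1 _ ((hV A).1 hA) ((Set.finite_singleton k).subset fun l hl => ?_)
    obtain ⟨c, hc⟩ := ((hU l).1 _ hl).nonempty
    by_contra hlk
    have := hj (l, c) hc (k, a) ha fun h => hlk (congrArg Prod.fst h)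
    rw [if_neg (show ¬ l = k from hlk), hj1] at this
    exact absurd this (by decide)
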